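/- Let r be a power of p and m = (m_j)_{j≥0} an integer sequence with m_0 = 1 and m_j ≥ 2 for all j ≥ 1. If moreover m_j ≥ 3 for all sufficiently large j, then t*(ξ(r,m)) ≤ limsup_{j→∞} (m_j + 2 m_j m_{j+1}). -/

import Mathlib

open Polynomial Filter Set
open scoped Classical

noncomputable section

namespace OotoT

variable (Fq : Type) [Field Fq]

/-- We model the field `F_q((T⁻¹))` of Laurent series in `T⁻¹` as `LaurentSeries Fq`,
whose canonical variable `u` plays the role of `T⁻¹`.  Thus `T` itself is `u⁻¹`. -/
def Tel : LaurentSeries Fq := (HahnSeries.single (1 : ℤ) (1 : Fq))⁻¹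

/-- The canonical ring embedding `F_q[T] → F_q((T⁻¹))`, sending `T ↦ u⁻¹`. -/
def ringHomT : Polynomial Fq →+* LaurentSeries Fq :=
  Polynomial.eval₂RingHom (HahnSeries.C : Fq →+* LaurentSeries Fq) (Tel Fq)

/-- The absolute value on `F_q((T⁻¹))`: `|0| = 0` and `|ξ| = q^{-N}` where
`ξ = Σ_{n ≥ N} a_n T^{-n}` with `a_N ≠ 0`; in our model `N` is the order of `ξ`
as a Hahn series in `u = T⁻¹`. -/
def absL (q : ℕ) (ξ : LaurentSeries Fq) : ℝ :=
  if ξ = 0 then 0 else (q : ℝ) ^ (-ξ.order)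

/-- Evaluation of a polynomial `P(X) ∈ (F_q[T])[X]` at `ξ ∈ F_q((T⁻¹))`. -/
def evalP (ξ : LaurentSeries Fq) (P : Polynomial (Polynomial Fq)) : LaurentSeries Fq :=
  Polynomial.eval₂ (ringHomT Fq) ξ P

/-- The height of `P(X) ∈ (F_q[T])[X]`: the maximum of the absolute values of its
coefficients.  A nonzero `c ∈ F_q[T]` has `|c| = q^{deg c}`, so for `P ≠ 0` the height
is `q` raised to the maximal degree of a (nonzero) coefficient of `P`. -/
def heightP (q : ℕ) (P : Polynomial (Polynomial Fq)) : ℝ :=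
  if P = 0 then 0 else (q : ℝ) ^ (P.support.sup fun i => (P.coeff i).natDegree)

/-- `w_n(ξ)`: the supremum (in the extended reals) of the real numbers `w` such that
`0 < |P(ξ)| ≤ H(P)^{-w}` for infinitely many `P(X) ∈ (F_q[T])[X]` of degree at most `n`. -/
def wn (q : ℕ) (n : ℕ) (ξ : LaurentSeries Fq) : EReal :=
  sSup ((fun w : ℝ => (w : EReal)) ''
    {w : ℝ | {P : Polynomial (Polynomial Fq) | P.natDegree ≤ n ∧
      0 < absL Fq q (evalP Fq ξ P) ∧
      absL Fq q (evalP Fq ξ P) ≤ heightP Fq q P ^ (-w)}.Infinite})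

/-- `w(ξ) = limsup_{n→∞} w_n(ξ)/n`. -/
def wB (q : ℕ) (ξ : LaurentSeries Fq) : EReal :=
  Filter.limsup (fun n : ℕ => wn Fq q n ξ / (n : EReal)) Filter.atTop

/-- `ξ` is an `A`-number if `w(ξ) = 0`. -/
def IsANumber (q : ℕ) (ξ : LaurentSeries Fq) : Prop := wB Fq q ξ = 0

/-- `ξ` is an `S`-number if `0 < w(ξ) < +∞`. -/
def IsSNumber (q : ℕ) (ξ : LaurentSeries Fq) : Prop := 0 < wB Fq q ξ ∧ wB Fq q ξ < ⊤

/-- `ξ` is a `T`-number if `w(ξ) = +∞` and `w_n(ξ) < +∞` for all `n ≥ 1`. -/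
def IsTNumber (q : ℕ) (ξ : LaurentSeries Fq) : Prop :=
  wB Fq q ξ = ⊤ ∧ ∀ n : ℕ, 1 ≤ n → wn Fq q n ξ < ⊤

/-- `ξ` is a `U`-number if `w(ξ) = +∞` and `w_n(ξ) = +∞` for some `n ≥ 1`. -/
def IsUNumber (q : ℕ) (ξ : LaurentSeries Fq) : Prop :=
  wB Fq q ξ = ⊤ ∧ ∃ n : ℕ, 1 ≤ n ∧ wn Fq q n ξ = ⊤

/-- The type `t(ξ) = limsup_{n→∞} (log w_n(ξ))/(log n)` of a `T`-number (as an
extended real; for a `T`-number each `w_n(ξ)` is a finite real, recovered by `toReal`). -/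
def typeT (q : ℕ) (ξ : LaurentSeries Fq) : EReal :=
  Filter.limsup
    (fun n : ℕ => ((Real.log (wn Fq q n ξ).toReal / Real.log n : ℝ) : EReal)) Filter.atTop

/-! ### The algebraic closure side -/

/-- The algebraic closure of `F_q((T⁻¹))`. -/
abbrev AC := AlgebraicClosure (LaurentSeries Fq)

/-- The canonical embedding of `F_q((T⁻¹))` into its algebraic closure. -/
def iota : LaurentSeries Fq →+* AC Fq := algebraMap _ _

/-- The embedding `F_q[T] → AC`. -/
def ringHomTC : Polynomial Fq →+* AC Fq := (iota Fq).comp (ringHomT Fq)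

/-- Evaluation of `P(X) ∈ (F_q[T])[X]` at an element of the algebraic closure. -/
def evalPC (α : AC Fq) (P : Polynomial (Polynomial Fq)) : AC Fq :=
  Polynomial.eval₂ (ringHomTC Fq) α P

/-- `P ∈ (F_q[T])[X]` is *the* minimal polynomial of `α`: it is non-constant, irreducible,
primitive, its leading coefficient is monic (in `T`), and `P(α) = 0`.  For `α` algebraic
over `F_q(T)` such a polynomial exists and is unique. -/
def IsMinPolyOf (α : AC Fq) (P : Polynomial (Polynomial Fq)) : Prop :=
  0 < P.natDegree ∧ Irreducible P ∧ P.IsPrimitive ∧ P.leadingCoeff.Monic ∧ evalPC Fq α P = 0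

/-- `α` is algebraic over `F_q(T)`. -/
def IsAlgT (α : AC Fq) : Prop := ∃ P, IsMinPolyOf Fq α P

/-- The degree of an algebraic `α`: the degree of its minimal polynomial. -/
def degT (α : AC Fq) : ℕ := if h : IsAlgT Fq α then h.choose.natDegree else 0

/-- The height of an algebraic `α`: the height of its minimal polynomial. -/
def heightT (q : ℕ) (α : AC Fq) : ℝ := if h : IsAlgT Fq α then heightP Fq q h.choose else 0

/-- The unique extension of the absolute value to the algebraic closure of `F_q((T⁻¹))`,
given by the standard formula `|x| = |N_{K(x)/K}(x)|^{1/[K(x):K]}`, i.e.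
`|x| = |c₀|^{1/d}` where `c₀` is the constant coefficient and `d` the degree of the
minimal polynomial of `x` over `K = F_q((T⁻¹))`. -/
def absC (q : ℕ) (x : AC Fq) : ℝ :=
  absL Fq q ((minpoly (LaurentSeries Fq) x).coeff 0) ^
    (((minpoly (LaurentSeries Fq) x).natDegree : ℝ)⁻¹)

/-- `w_n^*(ξ)`: the supremum (in the extended reals) of the real numbers `w` such that
`0 < |ξ - α| ≤ H(α)^{-w-1}` for infinitely many `α` algebraic over `F_q(T)` of degree
at most `n`. -/
def wnStar (q : ℕ) (n : ℕ) (ξ : LaurentSeries Fq) : EReal :=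
  sSup ((fun w : ℝ => (w : EReal)) ''
    {w : ℝ | {α : AC Fq | IsAlgT Fq α ∧ degT Fq α ≤ n ∧
      0 < absC Fq q (iota Fq ξ - α) ∧
      absC Fq q (iota Fq ξ - α) ≤ heightT Fq q α ^ (-w - 1)}.Infinite})

/-- `w^*(ξ) = limsup_{n→∞} w_n^*(ξ)/n`. -/
def wBStar (q : ℕ) (ξ : LaurentSeries Fq) : EReal :=
  Filter.limsup (fun n : ℕ => wnStar Fq q n ξ / (n : EReal)) Filter.atTop

/-- `ξ` is an `A*`-number if `w^*(ξ) = 0`. -/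
def IsAStarNumber (q : ℕ) (ξ : LaurentSeries Fq) : Prop := wBStar Fq q ξ = 0

/-- `ξ` is a `T*`-number if `w^*(ξ) = +∞` and `w_n^*(ξ) < +∞` for all `n ≥ 1`. -/
def IsTStarNumber (q : ℕ) (ξ : LaurentSeries Fq) : Prop :=
  wBStar Fq q ξ = ⊤ ∧ ∀ n : ℕ, 1 ≤ n → wnStar Fq q n ξ < ⊤

/-- The `*`-type `t^*(ξ) = limsup_{n→∞} (log w_n^*(ξ))/(log n)` of a `T*`-number. -/
def typeTStar (q : ℕ) (ξ : LaurentSeries Fq) : EReal :=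
  Filter.limsup
    (fun n : ℕ => ((Real.log (wnStar Fq q n ξ).toReal / Real.log n : ℝ) : EReal)) Filter.atTop

/-! ### The Laurent series `ξ(r, m)` -/

/-- `r_j = r^{m_0 m_1 ⋯ m_j}`. -/
def rr (r : ℕ) (m : ℕ → ℕ) (j : ℕ) : ℕ := r ^ (∏ i ∈ Finset.range (j + 1), m i)

/-- `α_j(r, m) = Σ_{n=1}^∞ T^{-r_j^n}`, i.e. the power series in `u = T⁻¹` whose
`k`-th coefficient is `1` exactly when `k = r_j^n` for some `n ≥ 1`. -/
def alphaJ (r : ℕ) (m : ℕ → ℕ) (j : ℕ) : LaurentSeries Fq :=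
  HahnSeries.ofPowerSeries ℤ Fq (PowerSeries.mk fun k =>
    if ∃ n : ℕ, 1 ≤ n ∧ k = rr r m j ^ n then 1 else 0)

/-- `ξ_a(r, m) = Σ_{j=0}^∞ a_j α_j(r, m)`, described coefficientwise: the coefficient of
`T^{-k}` is the (finite) sum over `j` of `a_j` times the coefficient of `T^{-k}` in
`α_j(r, m)`. -/
def xiA (r : ℕ) (m : ℕ → ℕ) (a : ℕ → ℕ) : LaurentSeries Fq :=
  HahnSeries.ofPowerSeries ℤ Fq (PowerSeries.mk fun k =>
    ∑ᶠ j : ℕ, (a j : Fq) * (if ∃ n : ℕ, 1 ≤ n ∧ k = rr r m j ^ n then 1 else 0))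

/-- `ξ(r, m) = Σ_{j=0}^∞ α_j(r, m)`. -/
def xi (r : ℕ) (m : ℕ → ℕ) : LaurentSeries Fq := xiA Fq r m fun _ => 1

/-! ### Algebraicity and algebraic dependence over `F_q(T)` for Laurent series -/

/-- `ξ ∈ F_q((T⁻¹))` is algebraic over `F_q(T)`. -/
def IsAlgLS (ξ : LaurentSeries Fq) : Prop :=
  ∃ P : Polynomial (Polynomial Fq), P ≠ 0 ∧ evalP Fq ξ P = 0

/-- Evaluation of a two-variable polynomial `F(X, Y) ∈ (F_q[T])[X, Y]` (coded as an
iterated polynomial ring, `T` innermost, then `X`, then `Y`) at `(ξ, η)`. -/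
def evalXY (ξ η : LaurentSeries Fq) (F : Polynomial (Polynomial (Polynomial Fq))) :
    LaurentSeries Fq :=
  Polynomial.eval₂ (Polynomial.eval₂RingHom (ringHomT Fq) ξ) η F

/-- `ξ` and `η` are algebraically dependent over `F_q(T)`. -/
def AlgDep (ξ η : LaurentSeries Fq) : Prop :=
  ∃ F : Polynomial (Polynomial (Polynomial Fq)), F ≠ 0 ∧ evalXY Fq ξ η F = 0

/-- `deg_X` of `F(X, Y) ∈ (F_q[T])[X, Y]` in our encoding. -/
def degX (F : Polynomial (Polynomial (Polynomial Fq))) : ℕ :=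
  F.support.sup fun i => (F.coeff i).natDegree

/-- `F(X, Y) ∈ (F_q[T])[X, Y]` is primitive (in `X` and `Y`): no non-unit of `F_q[T]`
divides all of its coefficients. -/
def IsPrimitiveXY (F : Polynomial (Polynomial (Polynomial Fq))) : Prop :=
  ∀ c : Polynomial Fq, (∀ i j : ℕ, c ∣ ((F.coeff i).coeff j)) → IsUnit c

end OotoT

namespace OotoT

/-- An absolute value on `K` that is nontrivial, nonarchimedean and complete extends to every
algebraic extension by the norm formula. -/
theorem exists_absoluteValue_extension {K L : Type*} [Field K] [Field L] [Algebra K L]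
    [Algebra.IsAlgebraic K L] (v : AbsoluteValue K ℝ) (hna : IsNonarchimedean v)
    (hnt : ∃ x, 1 < v x)
    (hc : ∀ u : ℕ → K, (∀ ε > 0, ∃ N, ∀ i ≥ N, ∀ j ≥ N, v (u i - u j) < ε) →
      ∃ a, ∀ ε > 0, ∃ N, ∀ i ≥ N, v (u i - a) < ε) :
    ∃ A : AbsoluteValue L ℝ, IsNonarchimedean A ∧
      (∀ x, A (algebraMap K L x) = v x) ∧
      ∀ x, A x = v ((minpoly K x).coeff 0) ^ (((minpoly K x).natDegree : ℝ)⁻¹) := by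
  let _ : NontriviallyNormedField K :=
    { v.toNormedField with
      non_trivial := hnt }
  have hnorm : ∀ x : K, ‖x‖ = v x := fun _ => rfl
  have : IsUltrametricDist K := IsUltrametricDist.isUltrametricDist_of_isNonarchimedean_norm hna
  have : CompleteSpace K := by
    refine Metric.complete_of_cauchySeq_tendsto fun u hu => ?_
    simp only [Metric.cauchySeq_iff, dist_eq_norm, hnorm] at hu
    obtain ⟨a, ha⟩ := hc u hu
    refine ⟨a, Metric.tendsto_atTop.2 ?_⟩
    simpa only [dist_eq_norm, hnorm] using ha
  refine ⟨⟨⟨spectralMulAlgNorm K L, map_mul _⟩, fun x => apply_nonneg _ x,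
    fun x => map_eq_zero_iff_eq_zero _, fun x y => map_add_le_add _ x y⟩, ?_, ?_, ?_⟩
  · exact isNonarchimedean_spectralNorm
  · exact fun x => spectralNorm_extends x
  · intro x
    rw [← one_div]
    exact spectralNorm.spectralNorm_eq_norm_coeff_zero_rpow K L x

section LaurentAbs

variable (Fq : Type) [Field Fq]

theorem absL_le_iff {q : ℕ} (hq : 2 ≤ q) (x : LaurentSeries Fq) (N : ℤ) :
    absL Fq q x ≤ (q : ℝ) ^ (-N) ↔ ∀ k < N, x.coeff k = 0 := by
  have hq1 : (1 : ℝ) < q := by exact_mod_cast hq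
  unfold absL
  split_ifs with h
  · simp only [h, HahnSeries.coeff_zero, implies_true, iff_true]
    positivity
  · rw [zpow_le_zpow_iff_right₀ hq1, neg_le_neg_iff, HahnSeries.le_order_iff_forall h]

/-- `absL` as an absolute value. -/
def absLV {q : ℕ} (hq : 2 ≤ q) : AbsoluteValue (LaurentSeries Fq) ℝ where
  toFun := absL Fq q
  map_mul' x y := by
    have hq0 : (q : ℝ) ≠ 0 := by positivity
    unfold absL
    by_cases hx : x = 0
    · simp [hx]
    by_cases hy : y = 0
    · simp [hy]
    simp only [hx, hy, mul_eq_zero, or_self, if_false]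
    rw [HahnSeries.order_mul hx hy, neg_add, zpow_add₀ hq0]
  nonneg' x := by
    unfold absL
    split_ifs <;> positivity
  eq_zero' x := by
    have : 0 < (q : ℝ) := by positivity
    unfold absL
    split_ifs with h
    · simp [h]
    · simp only [h, iff_false]
      positivity
  add_le' x y := by
    have hq1 : (1 : ℝ) ≤ q := by exact_mod_cast (by omega : 1 ≤ q)
    unfold absL
    by_cases hx : x = 0
    · simp [hx]
    by_cases hy : y = 0
    · simp [hy]
    by_cases hxy : x + y = 0
    · simp only [hx, hy, hxy, if_false, if_true]
      positivity
    simp only [hx, hy, hxy, if_false]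
    have h := HahnSeries.min_order_le_order_add hxy
    have hx0 : (0 : ℝ) < (q : ℝ) ^ (-x.order) := by positivity
    have hy0 : (0 : ℝ) < (q : ℝ) ^ (-y.order) := by positivity
    rcases min_le_iff.1 h with h | h
    · have := zpow_le_zpow_right₀ hq1 (neg_le_neg h)
      linarith
    · have := zpow_le_zpow_right₀ hq1 (neg_le_neg h)
      linarith

theorem absLV_apply {q : ℕ} (hq : 2 ≤ q) (x : LaurentSeries Fq) :
    absLV Fq hq x = absL Fq q x := rfl

theorem absLV_nonarchimedean {q : ℕ} (hq : 2 ≤ q) : IsNonarchimedean (absLV Fq hq) := by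
  have hq1 : (1 : ℝ) ≤ q := by exact_mod_cast (by omega : 1 ≤ q)
  intro x y
  simp only [absLV_apply]
  unfold absL
  by_cases hx : x = 0
  · simp [hx]
  by_cases hy : y = 0
  · simp [hy]
  by_cases hxy : x + y = 0
  · simp only [hx, hy, hxy, if_false, if_true]
    positivity
  simp only [hx, hy, hxy, if_false, le_max_iff]
  rcases min_le_iff.1 (HahnSeries.min_order_le_order_add hxy) with h | h
  · exact Or.inl (zpow_le_zpow_right₀ hq1 (neg_le_neg h))
  · exact Or.inr (zpow_le_zpow_right₀ hq1 (neg_le_neg h))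

theorem absL_complete {q : ℕ} (hq : 2 ≤ q) (u : ℕ → LaurentSeries Fq)
    (hu : ∀ ε > 0, ∃ N, ∀ i ≥ N, ∀ j ≥ N, absL Fq q (u i - u j) < ε) :
    ∃ a, ∀ ε > 0, ∃ N, ∀ i ≥ N, absL Fq q (u i - a) < ε := by
  have hq1 : (1 : ℝ) < q := by exact_mod_cast hq
  have hstab : ∀ k : ℤ, ∃ N, ∀ i ≥ N, ∀ j ≥ N, ∀ l < k, (u i).coeff l = (u j).coeff l := by
    intro k
    obtain ⟨N, hN⟩ := hu ((q : ℝ) ^ (-k)) (by positivity)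
    refine ⟨N, fun i hi j hj l hl => ?_⟩
    have := (absL_le_iff Fq hq _ k).1 (hN i hi j hj).le l hl
    rwa [HahnSeries.coeff_sub, sub_eq_zero] at this
  choose N hN using hstab
  obtain ⟨B, hB⟩ : ∃ B : ℤ, ∀ l < B, (u (N 0)).coeff l = 0 :=
    ⟨(u (N 0)).order, fun l hl => HahnSeries.coeff_eq_zero_of_lt_order hl⟩
  have hcoe : ∀ k l : ℤ, l < k → ∀ i ≥ N k, (u i).coeff l = (u (N (l + 1))).coeff l := by
    intro k l hlk i hi
    rw [hN k i hi (max (N k) (N (l + 1))) (le_max_left _ _) l hlk,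
      hN (l + 1) _ (le_max_right _ _) (N (l + 1)) le_rfl l (by omega)]
  have hbdd : BddBelow (Function.support fun l : ℤ => (u (N (l + 1))).coeff l) := by
    refine ⟨min B 0, fun l hl => ?_⟩
    by_contra hlt
    rw [not_le, lt_min_iff] at hlt
    exact hl (by beta_reduce; rw [← hcoe 0 l hlt.2 (N 0) le_rfl]; exact hB l hlt.1)
  refine ⟨HahnSeries.ofSuppBddBelow _ hbdd, fun ε hε => ?_⟩
  obtain ⟨k, hk⟩ := exists_pow_lt_of_lt_one hε (inv_lt_one_of_one_lt₀ hq1)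
  refine ⟨N k, fun i hi => lt_of_le_of_lt ((absL_le_iff Fq hq _ k).2 fun l hl => ?_)
    (by rwa [zpow_neg, zpow_natCast, ← inv_pow])⟩
  rw [HahnSeries.coeff_sub, HahnSeries.coeff_ofSuppBddBelow, hcoe k l hl i hi, sub_self]

theorem absL_Tel {q : ℕ} (hq : 2 ≤ q) : absL Fq q (Tel Fq) = q := by
  have h : absL Fq q (HahnSeries.single (1 : ℤ) (1 : Fq)) = (q : ℝ)⁻¹ := by
    unfold absL
    rw [if_neg (by simp), HahnSeries.order_single one_ne_zero, zpow_neg_one]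
  rw [Tel, ← absLV_apply Fq hq, map_inv₀, absLV_apply, h, inv_inv]

/-- `absC` is a nonarchimedean absolute value extending `absL`. -/
theorem exists_absC_absoluteValue {q : ℕ} (hq : 2 ≤ q) :
    ∃ A : AbsoluteValue (AC Fq) ℝ, IsNonarchimedean A ∧
      (∀ x, A (iota Fq x) = absL Fq q x) ∧ ∀ x, A x = absC Fq q x := by
  refine exists_absoluteValue_extension (absLV Fq hq) (absLV_nonarchimedean Fq hq)
    ⟨Tel Fq, ?_⟩ (absL_complete Fq hq)
  rw [absLV_apply, absL_Tel Fq hq]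
  exact_mod_cast hq

end LaurentAbs

section Nonarchimedean

variable {L : Type*} [Field L] {A : AbsoluteValue L ℝ}

theorem IsNonarchimedean.apply_sub_le (hA : IsNonarchimedean A) (x y : L) :
    A (x - y) ≤ max (A x) (A y) := by
  rw [sub_eq_add_neg, ← A.map_neg y]
  exact hA x (-y)

theorem IsNonarchimedean.sum_le_of_forall_le {ι : Type*} (hA : IsNonarchimedean A) {s : Finset ι}
    {f : ι → L} {B : ℝ} (hB : 0 ≤ B) (h : ∀ i ∈ s, A (f i) ≤ B) : A (∑ i ∈ s, f i) ≤ B := by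
  induction s using Finset.induction_on with
  | empty => simpa using hB
  | insert a s ha ih =>
    rw [Finset.sum_insert ha]
    exact (hA _ _).trans (max_le (h a (Finset.mem_insert_self a s))
      (ih fun i hi => h i (Finset.mem_insert_of_mem hi)))

theorem IsNonarchimedean.pow_sub_pow_le (hA : IsNonarchimedean A) {x y : L} (hx : A x ≤ 1)
    (hy : A y ≤ 1) (i : ℕ) : A (x ^ i - y ^ i) ≤ A (x - y) := by
  induction i with
  | zero => simp
  | succ i ih =>
    have : x ^ (i + 1) - y ^ (i + 1) = x * (x ^ i - y ^ i) + (x - y) * y ^ i := by ring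
    rw [this]
    refine (hA _ _).trans (max_le ?_ ?_)
    · rw [map_mul]
      exact (mul_le_of_le_one_left (A.nonneg _) hx).trans ih
    · rw [map_mul, map_pow]
      exact mul_le_of_le_one_right (A.nonneg _) (pow_le_one₀ (A.nonneg _) hy)

/-- A polynomial with coefficients bounded by `B` is `B`-Lipschitz on the closed unit disc. -/
theorem IsNonarchimedean.eval_sub_eval_le (hA : IsNonarchimedean A) {P : L[X]} {B : ℝ}
    (hB : 0 ≤ B) (hP : ∀ i, A (P.coeff i) ≤ B) {x y : L} (hx : A x ≤ 1) (hy : A y ≤ 1) :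
    A (P.eval x - P.eval y) ≤ B * A (x - y) := by
  rw [eval_eq_sum_range, eval_eq_sum_range, ← Finset.sum_sub_distrib]
  refine sum_le_of_forall_le hA (mul_nonneg hB (A.nonneg _)) fun i _ => ?_
  rw [← mul_sub, map_mul]
  exact mul_le_mul (hP i) (pow_sub_pow_le hA hx hy i) (A.nonneg _) hB

end Nonarchimedean

/-- An irreducible primitive polynomial over `D` and a polynomial not vanishing at one of its roots
have no common root. -/
theorem eval₂_ne_zero_of_irreducible {D L : Type*} [CommRing D] [IsDomain D]
    [NormalizedGCDMonoid D] [Field L] {φ : D →+* L} (hφ : Function.Injective φ) {P Q : D[X]}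
    (hirr : Irreducible P) (hprim : P.IsPrimitive) {x y : L} (hPx : P.eval₂ φ x = 0)
    (hQx : Q.eval₂ φ x ≠ 0) (hQy : Q.eval₂ φ y = 0) : P.eval₂ φ y ≠ 0 := by
  intro hPy
  let F := FractionRing D
  let ψ : F →+* L := IsFractionRing.lift hφ
  have hψ : ψ.comp (algebraMap D F) = φ := by
    ext d
    exact IsFractionRing.lift_algebraMap hφ d
  have hev : ∀ (S : D[X]) (z : L), (S.map (algebraMap D F)).eval₂ ψ z = S.eval₂ φ z := by
    intro S z
    rw [eval₂_map, hψ]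
  have hirrF : Irreducible (P.map (algebraMap D F)) :=
    (hprim.irreducible_iff_irreducible_map_fraction_map).1 hirr
  have hnd : ¬ P.map (algebraMap D F) ∣ Q.map (algebraMap D F) := by
    rintro ⟨S, hS⟩
    apply hQx
    rw [← hev, hS, eval₂_mul, hev, hPx, zero_mul]
  obtain ⟨a, b, hab⟩ := (hirrF.coprime_iff_not_dvd).2 hnd
  have := congrArg (eval₂ ψ y) hab
  rw [eval₂_add, eval₂_mul, eval₂_mul, hev, hev, hPy, hQy, mul_zero, mul_zero, add_zero,
    eval₂_one] at this
  exact zero_ne_one this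

/-- The polynomial `T^K (X - X^R) - B`. -/
def frobPoly {Fq : Type} [Field Fq] (K R : ℕ) (B : Fq[X]) : Fq[X][X] :=
  C (X ^ K) * (X - X ^ R) - C B

section Liouville

variable {Fq L : Type} [Field Fq] [Field L]

theorem eval₂_frobPoly (φ : Fq[X] →+* L) (K R : ℕ) (B : Fq[X]) (x : L) :
    (frobPoly K R B).eval₂ φ x = φ X ^ K * (x - x ^ R) - φ B := by
  simp [frobPoly, eval₂_sub, eval₂_mul, eval₂_pow]

theorem frobPoly_leading (K : ℕ) {R : ℕ} (hR : 2 ≤ R) (B : Fq[X]) :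
    (frobPoly K R B).natDegree = R ∧ (frobPoly K R B).leadingCoeff = - X ^ K := by
  have hle : (frobPoly K R B).natDegree ≤ R := by
    unfold frobPoly
    compute_degree
    omega
  have hco : (frobPoly K R B).coeff R = - X ^ K := by
    unfold frobPoly
    rw [coeff_sub, coeff_C_mul, coeff_sub, coeff_X, coeff_X_pow, coeff_C]
    simp [show (1 : ℕ) ≠ R by omega, show R ≠ 0 by omega]
  have hdeg : (frobPoly K R B).natDegree = R :=
    le_antisymm hle (le_natDegree_of_ne_zero (by rw [hco]; simp))
  exact ⟨hdeg, by rw [leadingCoeff, hdeg, hco]⟩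

theorem root_frobPoly_le_one {A : AbsoluteValue L ℝ} (hA : IsNonarchimedean A) {q : ℕ}
    (hq : 2 ≤ q) {φ : Fq[X] →+* L} (hφ1 : ∀ c, A (φ c) ≤ (q : ℝ) ^ c.natDegree)
    (hφX : A (φ X) = q) {K R : ℕ} (hR : 2 ≤ R) {B : Fq[X]} (hB : B.natDegree ≤ K) {x : L}
    (hx : (frobPoly K R B).eval₂ φ x = 0) : A x ≤ 1 := by
  have hq1 : (1 : ℝ) < q := by exact_mod_cast hq
  by_contra! h1
  rw [eval₂_frobPoly, sub_eq_zero] at hx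
  have hBle : A (φ B) ≤ (q : ℝ) ^ K := (hφ1 B).trans (pow_le_pow_right₀ hq1.le hB)
  rw [← hx, map_mul, map_pow, hφX, mul_le_iff_le_one_right (by positivity)] at hBle
  have hlt : A x < A (x ^ R) := by
    rw [map_pow]
    exact lt_self_pow₀ h1 (by omega)
  have h2 : A (x ^ R) ≤ max (A x) (A (x - x ^ R)) := by
    calc A (x ^ R) = A (x - (x - x ^ R)) := by ring_nf
      _ ≤ _ := IsNonarchimedean.apply_sub_le hA _ _
  rcases le_max_iff.1 h2 with h | h <;> linarith

/-- Liouville type lower bound for the value of `T^K (X - X^R) - B` at an algebraic element. -/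
theorem frobPoly_eval_lower_bound [IsAlgClosed L] {A : AbsoluteValue L ℝ}
    (hA : IsNonarchimedean A) {q : ℕ}
    (hq : 2 ≤ q) {φ : Fq[X] →+* L} (hφ1 : ∀ c, A (φ c) ≤ (q : ℝ) ^ c.natDegree)
    (hφX : A (φ X) = q) (hφ2 : ∀ c, c ≠ 0 → 1 ≤ A (φ c))
    {K R : ℕ} (hR : 2 ≤ R) {B : Fq[X]} (hB : B.natDegree ≤ K)
    {P : Fq[X][X]} (hirr : Irreducible P) (hprim : P.IsPrimitive) {n h : ℕ}
    (hn : P.natDegree ≤ n) (hh : ∀ i, (P.coeff i).natDegree ≤ h) {x : L} (hx : A x ≤ 1)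
    (hPx : P.eval₂ φ x = 0) (hQx : (frobPoly K R B).eval₂ φ x ≠ 0) :
    (q : ℝ) ^ K ≤ (q : ℝ) ^ (n * K + h * R) * A ((frobPoly K R B).eval₂ φ x) := by
  have hq1 : (1 : ℝ) < q := by exact_mod_cast hq
  have hφ : Function.Injective φ := by
    refine (injective_iff_map_eq_zero φ).2 fun c hc => ?_
    by_contra h0
    have := hφ2 c h0
    rw [hc, map_zero] at this
    linarith
  obtain ⟨hdeg, hlead⟩ := frobPoly_leading K hR B
  set Q := frobPoly K R B with hQ
  have hsplit : (Q.map φ).Splits := IsAlgClosed.splits _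
  have hdeg' : (Q.map φ).natDegree = R := by rw [natDegree_map_eq_of_injective hφ, hdeg]
  have hlead' : (Q.map φ).leadingCoeff = - φ X ^ K := by
    rw [leadingCoeff_map_of_injective hφ, hlead, map_neg, map_pow]
  have hcard : (Q.map φ).roots.card = R := by rw [← hsplit.natDegree_eq_card_roots, hdeg']
  have hQ0 : Q.map φ ≠ 0 := by
    intro h0
    rw [h0, natDegree_zero] at hdeg'
    omega
  have hroot : ∀ y ∈ (Q.map φ).roots, Q.eval₂ φ y = 0 := by
    intro y hy
    rw [← eval_map]
    exact (mem_roots hQ0).1 hy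
  have hres : φ (resultant Q P R P.natDegree) =
      (- φ X ^ K) ^ P.natDegree * ((Q.map φ).roots.map (P.map φ).eval).prod := by
    have := resultant_eq_prod_eval (Q.map φ) (P.map φ) P.natDegree natDegree_map_le hsplit
    rw [hdeg', hlead'] at this
    rw [← this, resultant_map_map]
  have hXK : φ X ^ K ≠ 0 := pow_ne_zero _ ((map_ne_zero_iff φ hφ).2 X_ne_zero)
  have hres0 : resultant Q P R P.natDegree ≠ 0 := by
    intro h0
    rw [h0, map_zero] at hres
    have hprod := (mul_eq_zero.1 hres.symm).resolve_left (pow_ne_zero _ (neg_ne_zero.2 hXK))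
    obtain ⟨y, hy, hy0⟩ := Multiset.mem_map.1 (Multiset.prod_eq_zero_iff.1 hprod)
    rw [eval_map] at hy0
    exact eval₂_ne_zero_of_irreducible hφ hirr hprim hPx hQx (hroot y hy) hy0
  have hQev : A (Q.eval₂ φ x) = (q : ℝ) ^ K * ((Q.map φ).roots.map fun y => A (x - y)).prod := by
    rw [← eval_map, hsplit.eval_eq_prod_roots, map_mul, hlead', A.map_neg, map_pow, hφX,
      map_multiset_prod, Multiset.map_map]
    rfl
  have hPy : ∀ y ∈ (Q.map φ).roots, A ((P.map φ).eval y) ≤ (q : ℝ) ^ h * A (x - y) := by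
    intro y hy
    have hPx' : (P.map φ).eval x = 0 := by rw [eval_map, hPx]
    rw [A.map_sub x y, ← sub_zero ((P.map φ).eval y), ← hPx']
    refine IsNonarchimedean.eval_sub_eval_le hA (by positivity) (fun i => ?_)
      (root_frobPoly_le_one hA hq hφ1 hφX hR hB (hroot y hy)) hx
    rw [coeff_map]
    exact (hφ1 _).trans (pow_le_pow_right₀ hq1.le (hh i))
  have hprod : ((Q.map φ).roots.map fun y => A ((P.map φ).eval y)).prod ≤
      (q : ℝ) ^ (h * R) * ((Q.map φ).roots.map fun y => A (x - y)).prod := by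
    calc _ ≤ ((Q.map φ).roots.map fun y => (q : ℝ) ^ h * A (x - y)).prod :=
          Multiset.prod_map_le_prod_map₀ _ _ (fun y _ => A.nonneg _) hPy
      _ = _ := by
          rw [Multiset.prod_map_mul, Multiset.map_const', Multiset.prod_replicate, hcard, pow_mul]
  have h1 := hφ2 _ hres0
  rw [hres, map_mul, map_pow, A.map_neg, map_pow, hφX, map_multiset_prod, Multiset.map_map] at h1
  have hpos : 0 ≤ ((Q.map φ).roots.map fun y => A (x - y)).prod :=
    Multiset.prod_nonneg fun a ha => by
      obtain ⟨y, _, rfl⟩ := Multiset.mem_map.1 ha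
      exact A.nonneg _
  have h2 : (1 : ℝ) ≤ (q : ℝ) ^ (n * K) *
      ((q : ℝ) ^ (h * R) * ((Q.map φ).roots.map fun y => A (x - y)).prod) := by
    refine h1.trans (mul_le_mul ?_ hprod ?_ (by positivity))
    · rw [← pow_mul]
      refine pow_le_pow_right₀ hq1.le ?_
      rw [mul_comm]
      exact Nat.mul_le_mul_right K hn
    · refine Multiset.prod_nonneg fun a ha => ?_
      obtain ⟨y, _, rfl⟩ := Multiset.mem_map.1 ha
      exact A.nonneg _
  rw [hQev, pow_add]
  have hqK : (0 : ℝ) < (q : ℝ) ^ K := by positivity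
  calc (q : ℝ) ^ K = (q : ℝ) ^ K * 1 := (mul_one _).symm
    _ ≤ (q : ℝ) ^ K * _ := mul_le_mul_of_nonneg_left h2 hqK.le
    _ = _ := by ring

end Liouville

section RingHomT

variable (Fq : Type) [Field Fq]

theorem coeff_ringHomT (c : Fq[X]) (k : ℕ) : (ringHomT Fq c).coeff (-(k : ℤ)) = c.coeff k := by
  have hTel : ∀ i : ℕ, Tel Fq ^ i = HahnSeries.single (-(i : ℤ)) (1 : Fq) := by
    intro i
    rw [Tel, HahnSeries.inv_single, HahnSeries.single_pow]
    simp
  induction c using Polynomial.induction_on' with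
  | add a b ha hb => rw [map_add, HahnSeries.coeff_add, ha, hb, coeff_add]
  | monomial i a =>
    have : ringHomT Fq (monomial i a) = HahnSeries.single (-(i : ℤ)) a := by
      simp only [ringHomT, coe_eval₂RingHom, eval₂_monomial, hTel]
      simp [HahnSeries.C_apply, HahnSeries.single_mul_single]
    rw [this, coeff_monomial, HahnSeries.coeff_single]
    simp [eq_comm]

theorem one_le_absL_ringHomT {q : ℕ} (hq : 2 ≤ q) {c : Fq[X]} (hc : c ≠ 0) :
    1 ≤ absL Fq q (ringHomT Fq c) := by
  have hq1 : (1 : ℝ) ≤ q := by exact_mod_cast (by omega : 1 ≤ q)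
  have h := coeff_ringHomT Fq c c.natDegree
  have hne : (ringHomT Fq c).coeff (-(c.natDegree : ℤ)) ≠ 0 := by
    rw [h]
    exact leadingCoeff_ne_zero.2 hc
  have h0 : ringHomT Fq c ≠ 0 := fun h0 => hne (by rw [h0]; rfl)
  rw [absL, if_neg h0]
  have := HahnSeries.order_le_of_coeff_ne_zero hne
  exact one_le_zpow₀ hq1 (by omega)

theorem ringHomT_X : ringHomT Fq X = Tel Fq := by
  simp [ringHomT]

theorem absL_ringHomT_le {q : ℕ} (hq : 2 ≤ q) (c : Fq[X]) :
    absL Fq q (ringHomT Fq c) ≤ (q : ℝ) ^ c.natDegree := by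
  have hq1 : (1 : ℝ) ≤ q := by exact_mod_cast (by omega : 1 ≤ q)
  conv_lhs => rw [c.as_sum_range_C_mul_X_pow]
  rw [map_sum, ← absLV_apply Fq hq]
  refine IsNonarchimedean.sum_le_of_forall_le (absLV_nonarchimedean Fq hq) (by positivity)
    fun i hi => ?_
  rw [map_mul, map_mul, map_pow, map_pow, ringHomT_X, absLV_apply _ _ (Tel Fq), absL_Tel Fq hq]
  have hC : absLV Fq hq (ringHomT Fq (C (c.coeff i))) ≤ 1 := by
    have := (absL_le_iff Fq hq (ringHomT Fq (C (c.coeff i))) 0).2 fun k hk => by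
      simp only [ringHomT, coe_eval₂RingHom, eval₂_C, HahnSeries.C_apply]
      exact HahnSeries.coeff_single_of_ne hk.ne
    rw [absLV_apply]
    simpa using this
  calc _ ≤ 1 * (q : ℝ) ^ i := mul_le_mul_of_nonneg_right hC (by positivity)
    _ ≤ _ := by
      rw [one_mul]
      exact pow_le_pow_right₀ hq1 (Nat.lt_succ_iff.1 (Finset.mem_range.1 hi))

end RingHomT

/-- The exponent `m_0 m_1 ⋯ m_j` of `r_j`. -/
def prodM (m : ℕ → ℕ) (j : ℕ) : ℕ := ∏ i ∈ Finset.range (j + 1), m i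

section ProdM

variable {m : ℕ → ℕ}

theorem prodM_succ (j : ℕ) : prodM m (j + 1) = prodM m j * m (j + 1) :=
  Finset.prod_range_succ _ _

theorem prodM_dvd {i j : ℕ} (h : i ≤ j) : prodM m i ∣ prodM m j :=
  Finset.prod_dvd_prod_of_subset _ _ _ (Finset.range_mono (by omega))

theorem lt_prodM (hm0 : m 0 = 1) (hm : ∀ j, 1 ≤ j → 2 ≤ m j) (j : ℕ) : j < prodM m j := by
  induction j with
  | zero => simp [prodM, hm0]
  | succ j ih =>
    rw [prodM_succ]
    have := hm (j + 1) (by omega)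
    nlinarith

end ProdM

section Coefficients

variable (Fq : Type) [Field Fq] (r : ℕ) (m : ℕ → ℕ)

/-- The power series in `u = T⁻¹` underlying `xi`. -/
def xiSeries : PowerSeries Fq := PowerSeries.mk fun k =>
  ∑ᶠ j : ℕ, ((1 : ℕ) : Fq) * (if ∃ n : ℕ, 1 ≤ n ∧ k = rr r m j ^ n then 1 else 0)

theorem xi_eq_ofPowerSeries : xi Fq r m = HahnSeries.ofPowerSeries ℤ Fq (xiSeries Fq r m) := rfl

variable {r m}

theorem eq_rr_pow_iff (hr : 2 ≤ r) {s : ℕ} (hs : 1 ≤ s) (j : ℕ) :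
    (∃ n : ℕ, 1 ≤ n ∧ r ^ s = rr r m j ^ n) ↔ prodM m j ∣ s := by
  have key : ∀ n, r ^ s = rr r m j ^ n ↔ s = prodM m j * n := by
    intro n
    rw [rr, ← pow_mul]
    exact Nat.pow_right_inj hr
  constructor
  · rintro ⟨n, _, hn⟩
    exact ⟨n, (key n).1 hn⟩
  · rintro ⟨n, hn⟩
    refine ⟨n, ?_, (key n).2 hn⟩
    rcases Nat.eq_zero_or_pos n with h | h
    · subst h
      omega
    · exact h

theorem coeff_xiSeries_pow (hr : 2 ≤ r) {s : ℕ} (hs : 1 ≤ s) :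
    PowerSeries.coeff (r ^ s) (xiSeries Fq r m) =
      ∑ᶠ j : ℕ, if prodM m j ∣ s then (1 : Fq) else 0 := by
  rw [xiSeries, PowerSeries.coeff_mk]
  refine finsum_congr fun j => ?_
  simp only [eq_rr_pow_iff hr hs, Nat.cast_one, one_mul]

theorem exists_pow_of_coeff_xiSeries_ne_zero (hm0 : m 0 = 1) (hm : ∀ j, 1 ≤ j → 2 ≤ m j) {k : ℕ}
    (hk : PowerSeries.coeff k (xiSeries Fq r m) ≠ 0) : ∃ s, 1 ≤ s ∧ k = r ^ s := by
  by_contra! h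
  apply hk
  rw [xiSeries, PowerSeries.coeff_mk]
  refine finsum_eq_zero_of_forall_eq_zero fun j => ?_
  rw [if_neg, mul_zero]
  rintro ⟨n, hn, hkn⟩
  have := lt_prodM hm0 hm j
  refine h (prodM m j * n) (Nat.mul_pos (by omega) hn) ?_
  rw [hkn, rr, ← pow_mul]
  rfl

theorem finite_support_dvd (hm0 : m 0 = 1) (hm : ∀ j, 1 ≤ j → 2 ≤ m j) {s : ℕ} (hs : 1 ≤ s) :
    (Function.support fun j : ℕ => if prodM m j ∣ s then (1 : Fq) else 0).Finite := by
  refine (Set.finite_lt_nat s).subset fun j hj => ?_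
  have hdvd : prodM m j ∣ s := by
    by_contra h
    exact hj (if_neg h)
  exact (lt_prodM hm0 hm j).trans_le (Nat.le_of_dvd hs hdvd)

variable {p : ℕ} [Fact p.Prime] [CharP Fq p]

theorem coeff_xiSeries_pow_expChar (k a : ℕ) :
    iterateFrobenius Fq p a (PowerSeries.coeff k (xiSeries Fq r m)) =
      PowerSeries.coeff k (xiSeries Fq r m) := by
  rw [xiSeries, PowerSeries.coeff_mk]
  refine finsum_induction (fun x : Fq => iterateFrobenius Fq p a x = x) (map_zero _)
    (fun x y hx hy => by rw [map_add, hx, hy]) fun j => ?_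
  split_ifs <;> simp

theorem coeff_xiSeries_frobenius (k a : ℕ) :
    PowerSeries.coeff k (xiSeries Fq r m ^ p ^ a) =
      if p ^ a ∣ k then PowerSeries.coeff (k / p ^ a) (xiSeries Fq r m) else 0 := by
  have hp : p ≠ 0 := (Fact.out : p.Prime).ne_zero
  have h : PowerSeries.map (iterateFrobenius Fq p a)
      (PowerSeries.expand (p ^ a) (pow_ne_zero a hp) (xiSeries Fq r m)) =
      xiSeries Fq r m ^ p ^ a :=
    MvPowerSeries.map_iterateFrobenius_expand p hp (xiSeries Fq r m) a
  rw [← h, PowerSeries.coeff_map, PowerSeries.coeff_expand]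
  split_ifs
  · exact coeff_xiSeries_pow_expChar Fq _ a
  · exact map_zero _

/-- The power series `ξ - ξ^{r_d}`. -/
def xiFrob (r : ℕ) (m : ℕ → ℕ) (d : ℕ) : PowerSeries Fq :=
  xiSeries Fq r m - xiSeries Fq r m ^ rr r m d

variable {Fq}

theorem coeff_xiFrob_pow (hr2 : 2 ≤ r) (hr : ∃ e, r = p ^ e) (hm0 : m 0 = 1)
    (hm : ∀ j, 1 ≤ j → 2 ≤ m j) (d : ℕ) {s : ℕ} (hs : prodM m d < s) :
    PowerSeries.coeff (r ^ s) (xiFrob Fq r m d) =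
      ∑ᶠ j : ℕ, ((if prodM m j ∣ s then (1 : Fq) else 0) -
        if prodM m j ∣ s - prodM m d then (1 : Fq) else 0) := by
  obtain ⟨e, he⟩ := hr
  have hrr : rr r m d = p ^ (e * prodM m d) := by
    rw [pow_mul, ← he]
    rfl
  have hrr' : rr r m d = r ^ prodM m d := rfl
  rw [finsum_sub_distrib (finite_support_dvd Fq hm0 hm (by omega))
    (finite_support_dvd Fq hm0 hm (by omega)), ← coeff_xiSeries_pow Fq hr2 (by omega),
    ← coeff_xiSeries_pow Fq hr2 (by omega), xiFrob, map_sub, hrr, coeff_xiSeries_frobenius, ← hrr,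
    hrr', if_pos (pow_dvd_pow r hs.le), Nat.pow_div hs.le (by omega)]

theorem coeff_xiFrob_eq_zero (hr2 : 2 ≤ r) (hr : ∃ e, r = p ^ e) (hm0 : m 0 = 1)
    (hm : ∀ j, 1 ≤ j → 2 ≤ m j) (d N : ℕ) {k : ℕ}
    (hk : r ^ (N * prodM m (d + 1) + prodM m d) < k)
    (hk' : k < r ^ ((N + 1) * prodM m (d + 1))) :
    PowerSeries.coeff k (xiFrob Fq r m d) = 0 := by
  by_cases hpow : ∃ s, k = r ^ s
  · obtain ⟨s, rfl⟩ := hpow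
    rw [Nat.pow_lt_pow_iff_right (by omega)] at hk hk'
    rw [coeff_xiFrob_pow hr2 hr hm0 hm d (by omega)]
    refine finsum_eq_zero_of_forall_eq_zero fun j => ?_
    rcases Nat.lt_or_ge d j with hj | hj
    · have hdvd : prodM m (d + 1) ∣ prodM m j := prodM_dvd hj
      have hno : ∀ t, N * prodM m (d + 1) < t → t < (N + 1) * prodM m (d + 1) →
          ¬ prodM m j ∣ t := by
        rintro t h1 h2 h3
        obtain ⟨c, rfl⟩ := hdvd.trans h3
        rw [mul_comm _ c] at h1 h2
        have h1' := lt_of_mul_lt_mul_right h1 (Nat.zero_le _)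
        have h2' := lt_of_mul_lt_mul_right h2 (Nat.zero_le _)
        omega
      rw [if_neg (hno _ (by omega) hk'), if_neg (hno _ (by omega) (by omega)), sub_zero]
    · have hdvd : prodM m j ∣ prodM m d := prodM_dvd hj
      have : prodM m j ∣ s ↔ prodM m j ∣ s - prodM m d :=
        ⟨fun h => Nat.dvd_sub h hdvd, fun h => by
          have := dvd_add h hdvd
          rwa [Nat.sub_add_cancel (by omega)] at this⟩
      simp only [this, sub_self]
  · have h0 : ∀ l, (∃ s, k = l * r ^ s) → PowerSeries.coeff l (xiSeries Fq r m) = 0 := by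
      rintro l ⟨s, hl⟩
      by_contra hne
      obtain ⟨t, _, rfl⟩ := exists_pow_of_coeff_xiSeries_ne_zero Fq hm0 hm hne
      exact hpow ⟨t + s, by rw [hl, pow_add]⟩
    obtain ⟨e, he⟩ := hr
    have hrr : rr r m d = p ^ (e * prodM m d) := by
      rw [pow_mul, ← he]
      rfl
    rw [xiFrob, map_sub, h0 k ⟨0, by simp⟩, hrr, coeff_xiSeries_frobenius, ← hrr]
    split_ifs with hdvd
    · rw [h0 (k / rr r m d) ⟨prodM m d, (Nat.div_mul_cancel hdvd).symm⟩, sub_zero]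
    · exact sub_zero 0

theorem coeff_xiFrob_eq_one (hr2 : 2 ≤ r) (hr : ∃ e, r = p ^ e) (hm0 : m 0 = 1)
    (hm : ∀ j, 1 ≤ j → 2 ≤ m j) (d N : ℕ) (hN : 1 ≤ N) (hdvd : ¬ m (d + 2) ∣ N) :
    PowerSeries.coeff (r ^ (N * prodM m (d + 1))) (xiFrob Fq r m d) = 1 := by
  have hM : d < prodM m d := lt_prodM hm0 hm d
  have hMS : prodM m d < prodM m (d + 1) := by
    rw [prodM_succ]
    have := hm (d + 1) (by omega)
    nlinarith
  have hNS : prodM m (d + 1) ≤ N * prodM m (d + 1) := Nat.le_mul_of_pos_left _ hN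
  have hsub : ∀ j, d + 1 ≤ j → ¬ prodM m j ∣ N * prodM m (d + 1) - prodM m d := by
    intro j hj h
    have h1 : prodM m (d + 1) ∣ N * prodM m (d + 1) - prodM m d := (prodM_dvd hj).trans h
    have h2 : prodM m (d + 1) ∣ prodM m d := by
      have := Nat.dvd_sub (Dvd.intro_left N rfl) h1
      rwa [Nat.sub_sub_self (by omega)] at this
    exact absurd (Nat.le_of_dvd (by omega) h2) (by omega)
  rw [coeff_xiFrob_pow hr2 hr hm0 hm d (by omega), finsum_eq_single _ (d + 1)]
  · rw [if_pos (Dvd.intro_left N rfl), if_neg (hsub _ le_rfl), sub_zero]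
  · intro j hj
    rcases lt_or_gt_of_ne hj with hlt | hgt
    · have hd : prodM m j ∣ prodM m d := prodM_dvd (by omega)
      have hd' : prodM m j ∣ N * prodM m (d + 1) :=
        (prodM_dvd hlt.le).trans (Dvd.intro_left N rfl)
      rw [if_pos hd', if_pos (Nat.dvd_sub hd' hd), sub_self]
    · rw [if_neg (hsub j hgt.le), if_neg, sub_zero]
      intro h
      have h1 : prodM m (d + 2) ∣ N * prodM m (d + 1) := (prodM_dvd hgt).trans h
      rw [prodM_succ (d + 1), mul_comm N] at h1
      exact hdvd (Nat.dvd_of_mul_dvd_mul_left (by omega) h1)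

end Coefficients

section Truncation

variable {Fq : Type} [Field Fq]

/-- Rational approximation of a power series in `T⁻¹` by truncation. -/
theorem exists_truncation {q : ℕ} (hq : 2 ≤ q) (f : PowerSeries Fq) (K : ℕ) :
    ∃ B : Fq[X], B.natDegree ≤ K ∧
      (∀ k₁ : ℕ, (∀ k, K < k → k < k₁ → PowerSeries.coeff k f = 0) →
        absL Fq q (Tel Fq ^ K * HahnSeries.ofPowerSeries ℤ Fq f - ringHomT Fq B) ≤
          (q : ℝ) ^ K * ((q : ℝ) ^ k₁)⁻¹) ∧
      (∀ k₀ : ℕ, K < k₀ → PowerSeries.coeff k₀ f ≠ 0 → (q : ℝ) ^ K * ((q : ℝ) ^ k₀)⁻¹ ≤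
        absL Fq q (Tel Fq ^ K * HahnSeries.ofPowerSeries ℤ Fq f - ringHomT Fq B)) := by
  have hq1 : (1 : ℝ) ≤ q := by exact_mod_cast (by omega : 1 ≤ q)
  have hTel : ∀ i : ℕ, Tel Fq ^ i = HahnSeries.single (-(i : ℤ)) (1 : Fq) := by
    intro i
    rw [Tel, HahnSeries.inv_single, HahnSeries.single_pow]
    simp
  set g : PowerSeries Fq := f - (PowerSeries.trunc (K + 1) f : PowerSeries Fq) with hg
  have hgc : ∀ k, PowerSeries.coeff k g = if K < k then PowerSeries.coeff k f else 0 := by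
    intro k
    rw [hg, map_sub, Polynomial.coeff_coe, PowerSeries.coeff_trunc]
    split_ifs with h1 h2 h2
    · omega
    · simp
    · simp
    · omega
  set B : Fq[X] := ∑ i ∈ Finset.range (K + 1), monomial (K - i) (PowerSeries.coeff i f) with hB
  have hBeq : ringHomT Fq B =
      Tel Fq ^ K * HahnSeries.ofPowerSeries ℤ Fq (PowerSeries.trunc (K + 1) f : PowerSeries Fq) := by
    have htr : (PowerSeries.trunc (K + 1) f : PowerSeries Fq) =
        ∑ i ∈ Finset.range (K + 1), PowerSeries.monomial i (PowerSeries.coeff i f) := by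
      ext k
      rw [Polynomial.coeff_coe, PowerSeries.coeff_trunc, map_sum]
      simp [PowerSeries.coeff_monomial]
    rw [htr, hB, map_sum, map_sum, Finset.mul_sum]
    refine Finset.sum_congr rfl fun i hi => ?_
    have hi' : i ≤ K := Nat.lt_succ_iff.1 (Finset.mem_range.1 hi)
    have h1 : HahnSeries.ofPowerSeries ℤ Fq (PowerSeries.monomial i (PowerSeries.coeff i f)) =
        HahnSeries.single (i : ℤ) (PowerSeries.coeff i f) := by
      have hmon : PowerSeries.monomial i (PowerSeries.coeff i f) =
          PowerSeries.C (PowerSeries.coeff i f) * PowerSeries.X ^ i := by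
        ext k
        simp [PowerSeries.coeff_monomial, PowerSeries.coeff_X_pow]
      rw [hmon, map_mul, HahnSeries.ofPowerSeries_C, HahnSeries.ofPowerSeries_X_pow,
        HahnSeries.C_apply, HahnSeries.single_mul_single, zero_add, mul_one]
    rw [h1, hTel, HahnSeries.single_mul_single, one_mul]
    simp only [ringHomT, coe_eval₂RingHom, eval₂_monomial, hTel, HahnSeries.C_apply,
      HahnSeries.single_mul_single, zero_add, mul_one]
    rw [show -((K - i : ℕ) : ℤ) = -(K : ℤ) + i by omega]
  have hdiff : Tel Fq ^ K * HahnSeries.ofPowerSeries ℤ Fq f - ringHomT Fq B =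
      Tel Fq ^ K * HahnSeries.ofPowerSeries ℤ Fq g := by
    rw [hBeq, hg, map_sub, mul_sub]
  have habs : absL Fq q (Tel Fq ^ K * HahnSeries.ofPowerSeries ℤ Fq f - ringHomT Fq B) =
      (q : ℝ) ^ K * absL Fq q (HahnSeries.ofPowerSeries ℤ Fq g) := by
    rw [hdiff, ← absLV_apply Fq hq, map_mul, map_pow, absLV_apply Fq hq (Tel Fq), absL_Tel Fq hq,
      absLV_apply]
  refine ⟨B, ?_, fun k₁ hk₁ => ?_, fun k₀ hk₀ hne => ?_⟩
  · refine natDegree_sum_le_of_forall_le _ _ fun i _ => (natDegree_monomial_le _).trans ?_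
    omega
  · rw [habs]
    refine mul_le_mul_of_nonneg_left ?_ (by positivity)
    rw [← zpow_natCast, ← zpow_neg]
    refine (absL_le_iff Fq hq _ k₁).2 fun l hl => ?_
    rw [PowerSeries.coeff_coe]
    split_ifs with hneg
    · rfl
    · rw [hgc]
      split_ifs with hK
      · exact hk₁ _ hK (by omega)
      · rfl
  · rw [habs]
    refine mul_le_mul_of_nonneg_left ?_ (by positivity)
    have hc : (HahnSeries.ofPowerSeries ℤ Fq g).coeff (k₀ : ℤ) ≠ 0 := by
      rw [HahnSeries.ofPowerSeries_apply_coeff, hgc, if_pos hk₀]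
      exact hne
    have h0 : HahnSeries.ofPowerSeries ℤ Fq g ≠ 0 := fun h0 => hc (by rw [h0]; rfl)
    rw [absL, if_neg h0, ← zpow_natCast, ← zpow_neg]
    exact zpow_le_zpow_right₀ hq1 (neg_le_neg (HahnSeries.order_le_of_coeff_ne_zero hc))

end Truncation

/-- The approximation of `ξ - ξ^{r_d}` by a rational function with denominator
`T^K`, `K = r_d r_{d+1}^N`. -/
theorem exists_frob_approximation {Fq : Type} [Field Fq] {q p : ℕ} (hq : 2 ≤ q) [Fact p.Prime]
    [CharP Fq p] {r : ℕ} (hr2 : 2 ≤ r) (hr : ∃ e, r = p ^ e) {m : ℕ → ℕ} (hm0 : m 0 = 1)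
    (hm : ∀ j, 1 ≤ j → 2 ≤ m j) (d N : ℕ) :
    ∃ B : Fq[X], B.natDegree ≤ rr r m (d + 1) ^ N * rr r m d ∧
      absL Fq q (Tel Fq ^ (rr r m (d + 1) ^ N * rr r m d) *
        (xi Fq r m - xi Fq r m ^ rr r m d) - ringHomT Fq B) ≤
        (q : ℝ) ^ (rr r m (d + 1) ^ N * rr r m d) * ((q : ℝ) ^ rr r m (d + 1) ^ (N + 1))⁻¹ ∧
      (q : ℝ) ^ (rr r m (d + 1) ^ N * rr r m d) * ((q : ℝ) ^ rr r m (d + 1) ^ (N + 2))⁻¹ ≤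
        absL Fq q (Tel Fq ^ (rr r m (d + 1) ^ N * rr r m d) *
          (xi Fq r m - xi Fq r m ^ rr r m d) - ringHomT Fq B) := by
  have hq1 : (1 : ℝ) ≤ q := by exact_mod_cast (by omega : 1 ≤ q)
  have hS : ∀ N, rr r m (d + 1) ^ N = r ^ (N * prodM m (d + 1)) := by
    intro N
    rw [mul_comm, pow_mul]
    rfl
  have hK : rr r m (d + 1) ^ N * rr r m d = r ^ (N * prodM m (d + 1) + prodM m d) := by
    rw [hS, pow_add]
    rfl
  have hMS : prodM m d < prodM m (d + 1) := by
    have hM : d < prodM m d := lt_prodM hm0 hm d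
    rw [prodM_succ]
    have := hm (d + 1) (by omega)
    nlinarith
  have hx : xi Fq r m - xi Fq r m ^ rr r m d = HahnSeries.ofPowerSeries ℤ Fq (xiFrob Fq r m d) := by
    rw [xi_eq_ofPowerSeries, xiFrob, map_sub, map_pow]
  obtain ⟨B, hB, hup, hlow⟩ := exists_truncation hq (xiFrob Fq r m d)
    (r ^ (N * prodM m (d + 1) + prodM m d))
  rw [hK, hx]
  refine ⟨B, hB, ?_, ?_⟩
  · rw [hS]
    exact hup _ fun k h1 h2 => coeff_xiFrob_eq_zero hr2 hr hm0 hm d N h1 h2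
  · have hcase : ∃ N', N' ≤ N + 2 ∧ N + 1 ≤ N' ∧ ¬ m (d + 2) ∣ N' := by
      by_cases h : m (d + 2) ∣ N + 1
      · refine ⟨N + 2, le_rfl, by omega, fun h2 => ?_⟩
        have h3 : m (d + 2) ∣ 1 := by
          have := Nat.dvd_sub h2 h
          rwa [show N + 2 - (N + 1) = 1 by omega] at this
        have := hm (d + 2) (by omega)
        have := Nat.dvd_one.1 h3
        omega
      · exact ⟨N + 1, by omega, le_rfl, h⟩
    obtain ⟨N', h1, h2, h3⟩ := hcase
    have hlow' := hlow (r ^ (N' * prodM m (d + 1))) (Nat.pow_lt_pow_right (by omega) (by nlinarith))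
      (by rw [coeff_xiFrob_eq_one hr2 hr hm0 hm d N' (by omega) h3]; exact one_ne_zero)
    refine le_trans (mul_le_mul_of_nonneg_left ?_ (by positivity)) hlow'
    rw [hS]
    refine inv_anti₀ (by positivity) (pow_le_pow_right₀ hq1 (Nat.pow_le_pow_right (by omega) ?_))
    exact Nat.mul_le_mul_right _ h1

theorem exists_exponent {n R S h : ℕ} (hR : 1 ≤ R) (hh : 1 ≤ h) (hS : 2 * n * R ≤ S)
    (hS2 : 2 ≤ S) : ∃ N, n * (S ^ N * R) + h * R < S ^ (N + 1) ∧ S ^ N ≤ 2 * R * h := by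
  have hstep : ∀ N, 2 * (n * (S ^ N * R)) ≤ S ^ (N + 1) := by
    intro N
    rw [pow_succ]
    calc 2 * (n * (S ^ N * R)) = S ^ N * (2 * n * R) := by ring
      _ ≤ S ^ N * S := Nat.mul_le_mul_left _ hS
  have hex : ∃ N, n * (S ^ N * R) + h * R < S ^ (N + 1) := by
    refine ⟨2 * (h * R), ?_⟩
    have h1 := hstep (2 * (h * R))
    have h2 : 2 * (h * R) + 1 < S ^ (2 * (h * R) + 1) := Nat.lt_pow_self hS2
    omega
  refine ⟨Nat.find hex, Nat.find_spec hex, ?_⟩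
  have hRh : 1 ≤ R * h := Nat.mul_pos hR hh
  rcases hN : Nat.find hex with _ | k
  · rw [pow_zero, mul_assoc]
    omega
  · have h1 := Nat.find_min hex (m := k) (by omega)
    have h2 := hstep k
    have h3 : 2 * R * h = 2 * (h * R) := by ring
    omega

theorem absL_xi_le_one (Fq : Type) [Field Fq] {q : ℕ} (hq : 2 ≤ q) (r : ℕ) (m : ℕ → ℕ) :
    absL Fq q (xi Fq r m) ≤ 1 := by
  have h := (absL_le_iff Fq hq (xi Fq r m) 0).2 fun k hk => by
    rw [xi_eq_ofPowerSeries, PowerSeries.coeff_coe, if_pos hk]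
  simpa using h

/-- Lower bound for the distance between `ξ(r, m)` and an algebraic element of degree at most `n`
and positive logarithmic height `h`. -/
theorem absC_xi_sub_lower_bound {Fq : Type} [Field Fq] {q p : ℕ} (hq : 2 ≤ q) [Fact p.Prime]
    [CharP Fq p] {r : ℕ} (hr2 : 2 ≤ r) (hr : ∃ e, r = p ^ e) {m : ℕ → ℕ} (hm0 : m 0 = 1)
    (hm : ∀ j, 1 ≤ j → 2 ≤ m j) {n d h : ℕ} (hn : 2 * n * rr r m d ≤ rr r m (d + 1)) (hh : 1 ≤ h)
    {P : Fq[X][X]} {α : AC Fq} (hP : IsMinPolyOf Fq α P) (hPn : P.natDegree ≤ n)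
    (hPh : ∀ i, (P.coeff i).natDegree ≤ h) :
    ((q : ℝ) ^ (2 * rr r m d * rr r m (d + 1) ^ 2 * h))⁻¹ ≤ absC Fq q (iota Fq (xi Fq r m) - α) := by
  obtain ⟨-, hirr, hprim, -, hPα⟩ := hP
  obtain ⟨A, hA, hAι, hAC⟩ := exists_absC_absoluteValue Fq hq
  have hq1 : (1 : ℝ) < q := by exact_mod_cast hq
  have hq0 : (0 : ℝ) < q := by linarith
  have hrr : ∀ j, 2 ≤ rr r m j := fun j => by
    have h0 : prodM m j ≠ 0 := (Nat.zero_le _).trans_lt (lt_prodM hm0 hm j) |>.ne'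
    exact hr2.trans (Nat.le_self_pow h0 r)
  have hR := hrr d
  have hS := hrr (d + 1)
  rw [← hAC]
  rcases le_or_gt 1 (A (iota Fq (xi Fq r m) - α)) with hfar | hnear
  · exact (inv_le_one_of_one_le₀ (one_le_pow₀ hq1.le)).trans hfar
  obtain ⟨N, hN1, hN2⟩ := exists_exponent (by omega : 1 ≤ rr r m d) hh hn hS
  obtain ⟨B, hB, hup, hlow⟩ := exists_frob_approximation (Fq := Fq) hq hr2 hr hm0 hm d N
  set R := rr r m d with hRdef
  set S := rr r m (d + 1) with hSdef
  set K := S ^ N * R with hK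
  set x := iota Fq (xi Fq r m) with hx
  have hx1 : A x ≤ 1 := by
    rw [hx, hAι]
    exact absL_xi_le_one Fq hq r m
  have hα1 : A α ≤ 1 := by
    have := IsNonarchimedean.apply_sub_le hA x (x - α)
    rw [sub_sub_cancel] at this
    exact this.trans (max_le hx1 hnear.le)
  have hφX : A (ringHomTC Fq X) = q := by
    rw [ringHomTC, RingHom.comp_apply, hAι, ringHomT_X, absL_Tel Fq hq]
  have hQx : A ((frobPoly K R B).eval₂ (ringHomTC Fq) x) =
      absL Fq q (Tel Fq ^ K * (xi Fq r m - xi Fq r m ^ R) - ringHomT Fq B) := by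
    rw [eval₂_frobPoly, ← hAι, hx, ringHomTC, RingHom.comp_apply, RingHom.comp_apply, ringHomT_X]
    simp only [map_sub, map_mul, map_pow]
  have hdist : A ((frobPoly K R B).eval₂ (ringHomTC Fq) x -
      (frobPoly K R B).eval₂ (ringHomTC Fq) α) ≤ (q : ℝ) ^ K * A (x - α) := by
    have : (frobPoly K R B).eval₂ (ringHomTC Fq) x - (frobPoly K R B).eval₂ (ringHomTC Fq) α =
        ringHomTC Fq X ^ K * ((x - α) - (x ^ R - α ^ R)) := by
      rw [eval₂_frobPoly, eval₂_frobPoly]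
      ring
    rw [this, map_mul, map_pow, hφX]
    refine mul_le_mul_of_nonneg_left ?_ (by positivity)
    exact (IsNonarchimedean.apply_sub_le hA _ _).trans
      (max_le le_rfl (IsNonarchimedean.pow_sub_pow_le hA hx1 hα1 R))
  have hqK : (0 : ℝ) < (q : ℝ) ^ K := by positivity
  rw [← hQx] at hup hlow
  by_cases hQα : (frobPoly K R B).eval₂ (ringHomTC Fq) α = 0
  · rw [hQα, sub_zero] at hdist
    have h1 := le_of_mul_le_mul_left (hlow.trans hdist) hqK
    refine le_trans (inv_anti₀ (by positivity) (pow_le_pow_right₀ hq1.le ?_)) h1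
    rw [pow_add]
    calc S ^ N * S ^ 2 ≤ 2 * R * h * S ^ 2 := Nat.mul_le_mul_right _ hN2
      _ = 2 * R * S ^ 2 * h := by ring
  · have h1 := frobPoly_eval_lower_bound hA hq (φ := ringHomTC Fq)
      (fun c => by
        rw [ringHomTC, RingHom.comp_apply, hAι]
        exact absL_ringHomT_le Fq hq c) hφX
      (fun c hc => by
        rw [ringHomTC, RingHom.comp_apply, hAι]
        exact one_le_absL_ringHomT Fq hq hc) hR hB hirr hprim hPn hPh hα1 hPα hQα
    have h2 : (q : ℝ) ^ K * ((q : ℝ) ^ (n * K + h * R))⁻¹ ≤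
        A ((frobPoly K R B).eval₂ (ringHomTC Fq) α) := by
      rw [← div_eq_mul_inv, div_le_iff₀' (by positivity)]
      exact h1
    have h3 : A ((frobPoly K R B).eval₂ (ringHomTC Fq) x) <
        (q : ℝ) ^ K * ((q : ℝ) ^ (n * K + h * R))⁻¹ :=
      hup.trans_lt (mul_lt_mul_of_pos_left
        (inv_strictAnti₀ (by positivity) (pow_lt_pow_right₀ hq1 hN1)) hqK)
    have h4 := IsNonarchimedean.apply_sub_le hA ((frobPoly K R B).eval₂ (ringHomTC Fq) x)
      ((frobPoly K R B).eval₂ (ringHomTC Fq) x - (frobPoly K R B).eval₂ (ringHomTC Fq) α)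
    rw [sub_sub_cancel] at h4
    have h5 : (q : ℝ) ^ K * ((q : ℝ) ^ (n * K + h * R))⁻¹ ≤ (q : ℝ) ^ K * A (x - α) := by
      rcases le_max_iff.1 h4 with h | h <;> linarith
    refine le_trans (inv_anti₀ (by positivity) (pow_le_pow_right₀ hq1.le ?_))
      (le_of_mul_le_mul_left h5 hqK)
    calc n * K + h * R ≤ n * (2 * R * h * R) + h * R := by
          rw [hK]
          gcongr
      _ = (2 * n * R) * (R * h) + R * h := by ring
      _ ≤ S * (R * h) + R * h := by gcongr
      _ = (S + 1) * (R * h) := by ring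
      _ ≤ (2 * S ^ 2) * (R * h) := Nat.mul_le_mul_right _ (by nlinarith)
      _ = 2 * R * S ^ 2 * h := by ring

theorem ringHomTC_injective (Fq : Type) [Field Fq] {q : ℕ} (hq : 2 ≤ q) :
    Function.Injective (ringHomTC Fq) := by
  refine (injective_iff_map_eq_zero _).2 fun c hc => ?_
  by_contra h0
  have h1 := one_le_absL_ringHomT Fq hq h0
  have h2 : ringHomT Fq c = 0 := (iota Fq).injective (by rw [map_zero]; exact hc)
  rw [h2, absL, if_pos rfl] at h1
  linarith

/-- There are only finitely many algebraic elements of degree at most `n` and height one. -/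
theorem finite_height_eq_one (Fq : Type) [Field Fq] [Fintype Fq] {q : ℕ} (hq : 2 ≤ q) (n : ℕ) :
    {α : AC Fq | ∃ P, IsMinPolyOf Fq α P ∧ P.natDegree ≤ n ∧
      ∀ i, (P.coeff i).natDegree = 0}.Finite := by
  have hfin := Polynomial.bUnion_roots_finite (ringHomTC Fq) n
    (Set.finite_range (C : Fq → Fq[X]))
  refine hfin.subset ?_
  rintro α ⟨P, hP, hPn, hP0⟩
  refine Set.mem_iUnion₂.2 ⟨P, ⟨hPn, fun i => ⟨(P.coeff i).coeff 0, ?_⟩⟩, ?_⟩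
  · exact (eq_C_of_natDegree_eq_zero (hP0 i)).symm
  · rw [Finset.mem_coe, Multiset.mem_toFinset, mem_roots']
    refine ⟨(Polynomial.map_ne_zero_iff (ringHomTC_injective Fq hq)).2 hP.2.1.ne_zero, ?_⟩
    rw [IsRoot, eval_map]
    exact hP.2.2.2.2

/-- Upper bound for the exponent `w_n^*` of `ξ(r, m)`. -/
theorem wnStar_xi_le {Fq : Type} [Field Fq] [Fintype Fq] {q p : ℕ} (hq : 2 ≤ q) [Fact p.Prime]
    [CharP Fq p] {r : ℕ} (hr2 : 2 ≤ r) (hr : ∃ e, r = p ^ e) {m : ℕ → ℕ} (hm0 : m 0 = 1)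
    (hm : ∀ j, 1 ≤ j → 2 ≤ m j) {n d : ℕ} (hn : 2 * n * rr r m d ≤ rr r m (d + 1)) :
    wnStar Fq q n (xi Fq r m) ≤ ((2 * rr r m d * rr r m (d + 1) ^ 2 : ℝ) : EReal) := by
  refine sSup_le ?_
  rintro _ ⟨w, hw, rfl⟩
  refine EReal.coe_le_coe_iff.2 ?_
  obtain ⟨α, ⟨hα, hdeg, -, hle⟩, hnot⟩ := hw.exists_notMem_finite (finite_height_eq_one Fq hq n)
  have hP := hα.choose_spec
  rw [degT, dif_pos hα] at hdeg
  rw [heightT, dif_pos hα, heightP, if_neg hP.2.1.ne_zero] at hle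
  set P := hα.choose
  set h := P.support.sup fun i => (P.coeff i).natDegree with hh
  have hPh : ∀ i, (P.coeff i).natDegree ≤ h := by
    intro i
    by_cases hi : i ∈ P.support
    · exact Finset.le_sup (f := fun i => (P.coeff i).natDegree) hi
    · rw [notMem_support_iff.1 hi, natDegree_zero]
      exact Nat.zero_le _
  have h1 : 1 ≤ h := by
    by_contra h0
    refine hnot ⟨P, hP, hdeg, fun i => ?_⟩
    have := hPh i
    omega
  have hlow := (absC_xi_sub_lower_bound hq hr2 hr hm0 hm hn h1 hP hdeg hPh).trans hle
  have hq1 : (1 : ℝ) < q := by exact_mod_cast hq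
  rw [← Real.rpow_natCast, ← Real.rpow_natCast, ← Real.rpow_neg (by positivity),
    ← Real.rpow_mul (by positivity), Real.rpow_le_rpow_left_iff hq1] at hlow
  push_cast at hlow
  have h1' : (1 : ℝ) ≤ h := by exact_mod_cast h1
  have h2 : (h : ℝ) * (w + 1) ≤ h * (2 * rr r m d * rr r m (d + 1) ^ 2) := by linarith
  have := le_of_mul_le_mul_left h2 (by linarith)
  linarith

theorem isMinPolyOf_X_sub_C (Fq : Type) [Field Fq] (c : Fq[X]) :
    IsMinPolyOf Fq (ringHomTC Fq c) (X - C c) := by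
  refine ⟨by rw [natDegree_X_sub_C]; exact one_pos, irreducible_X_sub_C c,
    (monic_X_sub_C c).isPrimitive, ?_, ?_⟩
  · rw [(monic_X_sub_C c).leadingCoeff]
    exact monic_one
  · rw [evalPC, eval₂_sub, eval₂_X, eval₂_C, sub_self]

/-- The minimal polynomial of `c ∈ F_q[T]` has degree one and height at least `|c|`. -/
theorem IsMinPolyOf.degree_height {Fq : Type} [Field Fq] {q : ℕ} (hq : 2 ≤ q) {c : Fq[X]}
    (hc : c ≠ 0) {P : Fq[X][X]} (hP : IsMinPolyOf Fq (ringHomTC Fq c) P) :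
    P.natDegree = 1 ∧ c.natDegree ≤ P.support.sup fun i => (P.coeff i).natDegree := by
  have hroot : P.IsRoot c := by
    have h := hP.2.2.2.2
    rw [evalPC, eval₂_at_apply] at h
    exact ringHomTC_injective Fq hq (by rw [map_zero]; exact h)
  obtain ⟨U, hU⟩ := dvd_iff_isRoot.2 hroot
  have hunit : IsUnit U := (hP.2.1.isUnit_or_isUnit hU).resolve_left
    (irreducible_X_sub_C c).not_isUnit
  obtain ⟨a, -, ha⟩ := Polynomial.isUnit_iff.1 hunit
  have ha0 : a ≠ 0 := by
    rintro rfl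
    rw [← ha, C_0] at hunit
    exact not_isUnit_zero hunit
  rw [← ha] at hU
  refine ⟨by rw [hU, natDegree_mul_C ha0, natDegree_X_sub_C], ?_⟩
  have h0 : P.coeff 0 = -c * a := by
    rw [hU, coeff_mul_C, coeff_sub, coeff_X_zero, coeff_C_zero, zero_sub]
  have hne : P.coeff 0 ≠ 0 := by
    rw [h0]
    exact mul_ne_zero (neg_ne_zero.2 hc) ha0
  refine le_trans ?_ (Finset.le_sup (f := fun i => (P.coeff i).natDegree) (mem_support_iff.2 hne))
  change c.natDegree ≤ (P.coeff 0).natDegree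
  rw [h0, natDegree_mul (neg_ne_zero.2 hc) ha0, natDegree_neg]
  exact Nat.le_add_right _ _

/-- A crude lower bound for `w_n^*`, coming from approximation by powers of `T`. -/
theorem neg_two_le_wnStar {Fq : Type} [Field Fq] {q : ℕ} (hq : 2 ≤ q) {ξ : LaurentSeries Fq}
    (hξ : absL Fq q ξ ≤ 1) {n : ℕ} (hn : 1 ≤ n) : ((-2 : ℝ) : EReal) ≤ wnStar Fq q n ξ := by
  obtain ⟨A, hA, hAι, hAC⟩ := exists_absC_absoluteValue Fq hq
  have hq1 : (1 : ℝ) < q := by exact_mod_cast hq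
  refine le_sSup ⟨-2, ?_, rfl⟩
  have hinj : Function.Injective fun k : ℕ => ringHomTC Fq (X ^ (k + 1)) := by
    intro k l hkl
    have h := congrArg natDegree (ringHomTC_injective Fq hq hkl)
    rw [natDegree_X_pow, natDegree_X_pow] at h
    omega
  refine (Set.infinite_range_of_injective hinj).mono ?_
  rintro _ ⟨k, rfl⟩
  have hα : IsAlgT Fq (ringHomTC Fq (X ^ (k + 1))) := ⟨_, isMinPolyOf_X_sub_C Fq _⟩
  obtain ⟨h1, h2⟩ := hα.choose_spec.degree_height hq (pow_ne_zero _ X_ne_zero)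
  rw [natDegree_X_pow] at h2
  have hT : A (ringHomTC Fq (X ^ (k + 1))) = (q : ℝ) ^ (k + 1) := by
    rw [map_pow, map_pow, ringHomTC, RingHom.comp_apply, hAι, ringHomT_X, absL_Tel Fq hq]
  have hqk : (1 : ℝ) < (q : ℝ) ^ (k + 1) := one_lt_pow₀ hq1 (by omega)
  have hup := IsNonarchimedean.apply_sub_le hA (iota Fq ξ) (ringHomTC Fq (X ^ (k + 1)))
  have hlow := IsNonarchimedean.apply_sub_le hA (iota Fq ξ)
    (iota Fq ξ - ringHomTC Fq (X ^ (k + 1)))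
  rw [sub_sub_cancel, hT, hAι] at hlow
  rw [hT, hAι, max_eq_right (hξ.trans hqk.le)] at hup
  refine ⟨hα, ?_, ?_, ?_⟩
  · rw [degT, dif_pos hα, h1]
    exact hn
  · rw [← hAC]
    rcases le_max_iff.1 hlow with h | h <;> linarith
  · rw [← hAC, heightT, dif_pos hα, heightP, if_neg hα.choose_spec.2.1.ne_zero,
      show (-(-2 : ℝ) - 1) = 1 by norm_num, Real.rpow_one]
    exact hup.trans (pow_le_pow_right₀ hq1.le h2)

theorem log_toReal_le_log {w : EReal} {C : ℝ} (hC : 2 ≤ C) (h1 : ((-2 : ℝ) : EReal) ≤ w)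
    (h2 : w ≤ (C : EReal)) : Real.log w.toReal ≤ Real.log C := by
  have hbot : w ≠ ⊥ := fun h => by simp [h] at h1
  have htop : w ≠ ⊤ := fun h => by simp [h] at h2
  have h3 := EReal.toReal_le_toReal h1 (EReal.coe_ne_bot _) htop
  have h4 := EReal.toReal_le_toReal h2 hbot (EReal.coe_ne_top _)
  rw [EReal.toReal_coe] at h3 h4
  rcases eq_or_ne w.toReal 0 with h0 | h0
  · rw [h0, Real.log_zero]
    exact Real.log_nonneg (by linarith)
  · rw [← Real.log_abs]
    exact Real.log_le_log (abs_pos.2 h0) (abs_le.2 ⟨by linarith, h4⟩)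

section Index

variable {r : ℕ} {m : ℕ → ℕ}

theorem lt_rr (hr2 : 2 ≤ r) (hm0 : m 0 = 1) (hm : ∀ j, 1 ≤ j → 2 ≤ m j) (j : ℕ) :
    j < rr r m j :=
  (lt_prodM hm0 hm j).trans (Nat.lt_pow_self hr2)

theorem rr_mono (hr2 : 2 ≤ r) (hm0 : m 0 = 1) (hm : ∀ j, 1 ≤ j → 2 ≤ m j) : Monotone (rr r m) := by
  refine fun i j hij => Nat.pow_le_pow_right (by omega) (Nat.le_of_dvd ?_ (prodM_dvd hij))
  exact (Nat.zero_le _).trans_lt (lt_prodM hm0 hm j)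

theorem exists_index (hr2 : 2 ≤ r) (hm0 : m 0 = 1) (hm : ∀ j, 1 ≤ j → 2 ≤ m j) :
    ∃ J : ℕ → ℕ, Tendsto J atTop atTop ∧ (∀ n, n < rr r m (J n)) ∧
      ∀ n k, J n = k + 1 → rr r m k ≤ n := by
  have hex : ∀ n, ∃ j, n < rr r m j := fun n => ⟨n, lt_rr hr2 hm0 hm n⟩
  refine ⟨fun n => Nat.find (hex n), tendsto_atTop.2 fun b => ?_, fun n => Nat.find_spec (hex n),
    fun n k hk => ?_⟩
  · filter_upwards [eventually_ge_atTop (rr r m b)] with n hn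
    by_contra hlt
    have h1 := Nat.find_spec (hex n)
    have h2 := rr_mono hr2 hm0 hm (le_of_not_ge hlt)
    omega
  · exact not_lt.1 (Nat.find_min (hex n) ((Nat.lt_succ_self k).trans_eq hk.symm))

/-- The estimate of `log (2 r_{k+1} r_{k+2}^2) / log n` for `r_k ≤ n`. -/
theorem log_bound_div_log_le (hr2 : 2 ≤ r) (hm0 : m 0 = 1) (hm : ∀ j, 1 ≤ j → 2 ≤ m j) {n k : ℕ}
    (hn : rr r m k ≤ n) :
    Real.log (2 * rr r m (k + 1) * rr r m (k + 2) ^ 2) / Real.log n ≤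
      ((m (k + 1) : ℝ) + 2 * m (k + 1) * m (k + 2)) + Real.log 2 / Real.log n := by
  have hlr : 0 < Real.log r := Real.log_pos (by exact_mod_cast hr2)
  have hrr : ∀ j, Real.log (rr r m j) = prodM m j * Real.log r := fun j => by
    rw [rr, Nat.cast_pow, Real.log_pow]
    rfl
  have hrr0 : ∀ j, (rr r m j : ℝ) ≠ 0 := fun j => by
    exact_mod_cast ((Nat.zero_le _).trans_lt (lt_rr hr2 hm0 hm j)).ne'
  have hM : (0 : ℝ) < prodM m k := by
    exact_mod_cast (Nat.zero_le _).trans_lt (lt_prodM hm0 hm k)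
  have hlog : prodM m k * Real.log r ≤ Real.log n := by
    rw [← hrr]
    refine Real.log_le_log ?_ (by exact_mod_cast hn)
    exact_mod_cast (Nat.zero_le _).trans_lt (lt_rr hr2 hm0 hm k)
  have hpos : 0 < Real.log n := (mul_pos hM hlr).trans_le hlog
  rw [Real.log_mul (mul_ne_zero two_ne_zero (hrr0 _)) (pow_ne_zero _ (hrr0 _)),
    Real.log_mul two_ne_zero (hrr0 _), Real.log_pow, hrr, hrr, prodM_succ, prodM_succ, prodM_succ]
  have hkey : ((m (k + 1) : ℝ) + 2 * m (k + 1) * m (k + 2)) * (prodM m k * Real.log r) ≤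
      ((m (k + 1) : ℝ) + 2 * m (k + 1) * m (k + 2)) * Real.log n :=
    mul_le_mul_of_nonneg_left hlog (by positivity)
  rw [div_le_iff₀ hpos, add_mul, div_mul_cancel₀ _ hpos.ne']
  push_cast
  linarith

end Index

theorem typeTStar_xi_le {Fq : Type} [Field Fq] [Fintype Fq] {q p : ℕ} (hq : 2 ≤ q) [Fact p.Prime]
    [CharP Fq p] {r : ℕ} (hr2 : 2 ≤ r) (hr : ∃ e, r = p ^ e) {m : ℕ → ℕ} (hm0 : m 0 = 1)
    (hm : ∀ j, 1 ≤ j → 2 ≤ m j) (hm3 : ∀ᶠ j in atTop, 3 ≤ m j) :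
    typeTStar Fq q (xi Fq r m) ≤
      limsup (fun j : ℕ => (((m j : ℝ) + 2 * (m j : ℝ) * (m (j + 1) : ℝ) : ℝ) : EReal)) atTop := by
  obtain ⟨J, hJ, hJlt, hJle⟩ := exists_index hr2 hm0 hm
  set a : ℕ → EReal := fun j => (((m j : ℝ) + 2 * (m j : ℝ) * (m (j + 1) : ℝ) : ℝ) : EReal)
  set v : ℕ → EReal := fun n => ((Real.log 2 / Real.log n : ℝ) : EReal)
  have hv : limsup v atTop = 0 := by
    refine Tendsto.limsup_eq ?_
    rw [← EReal.coe_zero]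
    refine (continuous_coe_real_ereal.tendsto 0).comp ?_
    exact tendsto_const_nhds.div_atTop (Real.tendsto_log_atTop.comp tendsto_natCast_atTop_atTop)
  have hbound : typeTStar Fq q (xi Fq r m) ≤ limsup ((a ∘ J) + v) atTop := by
    refine limsup_le_limsup ?_
    filter_upwards [eventually_ge_atTop 1, hJ.eventually (eventually_ge_atTop 1),
      hJ.eventually ((tendsto_add_atTop_nat 1).eventually hm3)] with n hn hJ1 hJ3
    obtain ⟨k, hk⟩ : ∃ k, J n = k + 1 := ⟨J n - 1, by omega⟩
    have hlt := hJlt n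
    have hle := hJle n k hk
    simp only [Pi.add_apply, Function.comp_apply, a, v]
    rw [hk] at hlt hJ3 ⊢
    rw [← EReal.coe_add, EReal.coe_le_coe_iff]
    have hR : 2 ≤ rr r m (k + 1) := by omega
    have hS : 2 * n * rr r m (k + 1) ≤ rr r m (k + 2) := by
      have hpow : rr r m (k + 2) = rr r m (k + 1) ^ m (k + 2) := by
        rw [rr, rr, ← pow_mul, Finset.prod_range_succ _ (k + 2)]
      calc 2 * n * rr r m (k + 1) ≤ rr r m (k + 1) * rr r m (k + 1) * rr r m (k + 1) := by gcongr
        _ = rr r m (k + 1) ^ 3 := by ring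
        _ ≤ _ := by
          rw [hpow]
          exact Nat.pow_le_pow_right (by omega) hJ3
    have hS1 : 1 ≤ rr r m (k + 2) := (Nat.zero_le _).trans_lt (lt_rr hr2 hm0 hm (k + 2))
    have hC : (2 : ℝ) ≤ 2 * rr r m (k + 1) * rr r m (k + 2) ^ 2 := by
      have : 2 ≤ 2 * rr r m (k + 1) * rr r m (k + 2) ^ 2 := by
        have := Nat.mul_pos (by omega : 0 < rr r m (k + 1)) (pow_pos hS1 2)
        rw [mul_assoc]
        omega
      exact_mod_cast this
    refine le_trans (div_le_div_of_nonneg_right (log_toReal_le_log hC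
      (neg_two_le_wnStar hq (absL_xi_le_one Fq hq r m) hn)
      (wnStar_xi_le hq hr2 hr hm0 hm hS)) (Real.log_natCast_nonneg n)) ?_
    exact log_bound_div_log_le hr2 hm0 hm hle
  calc typeTStar Fq q (xi Fq r m) ≤ limsup ((a ∘ J) + v) atTop := hbound
    _ ≤ limsup (a ∘ J) atTop + limsup v atTop :=
      EReal.limsup_add_le (Or.inr (by rw [hv]; exact EReal.zero_ne_top))
        (Or.inr (by rw [hv]; exact EReal.zero_ne_bot))
    _ = limsup (a ∘ J) atTop := by rw [hv, add_zero]
    _ ≤ limsup a atTop := limsup_le_limsup_of_le hJ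

end OotoT

open OotoT

/-- If moreover `m_j ≥ 3` for all sufficiently large `j`, then
`t*(ξ(r,m)) ≤ limsup_j (m_j + 2 m_j m_{j+1})`. -/
theorem starType_upper_bound (p : ℕ) (hp : p.Prime) (q : ℕ) (hq : ∃ e : ℕ, 0 < e ∧ q = p ^ e)
    (Fq : Type) [Field Fq] [Fintype Fq] [CharP Fq p] (hcard : Fintype.card Fq = q)
    (r : ℕ) (hr : ∃ e : ℕ, 0 < e ∧ r = p ^ e)
    (m : ℕ → ℕ) (hm0 : m 0 = 1) (hm : ∀ j : ℕ, 1 ≤ j → 2 ≤ m j)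
    (hm3 : ∀ᶠ j in Filter.atTop, 3 ≤ m j) :
    typeTStar Fq q (xi Fq r m)
      ≤ Filter.limsup (fun j : ℕ =>
          (((m j : ℝ) + 2 * (m j : ℝ) * (m (j + 1) : ℝ) : ℝ) : EReal)) Filter.atTop := by
  obtain ⟨e, he, rfl⟩ := hq
  obtain ⟨f, hf, rfl⟩ := hr
  have : Fact p.Prime := ⟨hp⟩
  exact typeTStar_xi_le (p := p) (hp.two_le.trans (Nat.le_self_pow he.ne' p))
    (hp.two_le.trans (Nat.le_self_pow hf.ne' p)) ⟨f, rfl⟩ hm0 hm hm3
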